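/- Let n ≥ 1, θ_j > 0 rational, and p_{j,r} : [0,T] → ℝ continuous (1 ≤ j ≤ n, 1 ≤ r ≤ n+1). A function tuple (v_1, …, v_n) with v_j ∈ C([0,T]) solves the integral system v_j(t) = ψ_j(t) + Σ_{r=1}^n I^{θ_j}(p_{j,r} v_r)(t) + I^{θ_j}(p_{j,n+1})(t), where ψ_j(t) = Σ_{k=0}^{⌈θ_j⌉−1} (v_{j,0}^{(k)}/k!) t^k, if and only if v_j is ⌈θ_j⌉ times differentiable with v_j^{(k)}(0) = v_{j,0}^{(k)} and D_C^{θ_j} v_j(t) = Σ_{r=1}^n p_{j,r}(t) v_r(t) + p_{j,n+1}(t) on [0,T], provided v_j ∈ C^{⌈θ_j⌉}([0,T]). -/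

import Mathlib

open MeasureTheory

/-- Riemann–Liouville fractional integral of order `α`, with `I⁰ f = f`. -/
noncomputable def RL (α : ℝ) (f : ℝ → ℝ) (u : ℝ) : ℝ :=
  if α = 0 then f u
  else (Real.Gamma α)⁻¹ * ∫ w in (0:ℝ)..u, (u - w) ^ (α - 1) * f w

/-- Caputo fractional derivative of order `θ` on `[0, T]`. -/
noncomputable def caputo (θ : ℝ) (T : ℝ) (v : ℝ → ℝ) : ℝ → ℝ :=
  RL ((⌈θ⌉₊ : ℝ) - θ) (iteratedDerivWithin ⌈θ⌉₊ v (Set.Icc 0 T))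

section FracSys
open Set Filter Topology

/-- Scaled real Beta integral. -/
lemma fs_beta (α β : ℝ) (hα : 0 < α) (hβ : 0 < β) (a : ℝ) (ha : 0 < a) :
    ∫ x in (0:ℝ)..a, x ^ (β - 1) * (a - x) ^ (α - 1) =
      a ^ (α + β - 1) * (Real.Gamma α * Real.Gamma β / Real.Gamma (α + β)) := by
  have h := Complex.betaIntegral_scaled (β : ℂ) (α : ℂ) ha
  rw [Complex.betaIntegral_eq_Gamma_mul_div _ _ (by simpa using hβ) (by simpa using hα)] at h
  apply Complex.ofReal_injective
  rw [← intervalIntegral.integral_ofReal]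
  have e : ∫ x in (0:ℝ)..a, (((x ^ (β - 1) * (a - x) ^ (α - 1) : ℝ)) : ℂ) =
      ∫ x in (0:ℝ)..a, (x : ℂ) ^ ((β : ℂ) - 1) * ((a : ℂ) - x) ^ ((α : ℂ) - 1) := by
    apply intervalIntegral.integral_congr
    intro x hx
    rw [uIcc_of_le ha.le] at hx
    simp only
    rw [Complex.ofReal_mul, Complex.ofReal_cpow hx.1, Complex.ofReal_cpow (sub_nonneg.2 hx.2)]
    push_cast
    rfl
  rw [e, h]
  push_cast
  rw [Complex.ofReal_cpow ha.le, ← Complex.Gamma_ofReal, ← Complex.Gamma_ofReal,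
    ← Complex.Gamma_ofReal]
  push_cast
  rw [add_comm (β : ℂ) α, mul_comm (Complex.Gamma (β:ℂ))]

lemma fs_beta' (α β : ℝ) (hα : 0 < α) (hβ : 0 < β) (s u : ℝ) (hs : s < u) :
    ∫ w in s..u, (u - w) ^ (α - 1) * (w - s) ^ (β - 1) =
      (u - s) ^ (α + β - 1) * (Real.Gamma α * Real.Gamma β / Real.Gamma (α + β)) := by
  rw [← fs_beta α β hα hβ (u - s) (sub_pos.2 hs)]
  have := intervalIntegral.integral_comp_sub_right
    (fun x => x ^ (β - 1) * (u - s - x) ^ (α - 1)) s (a := s) (b := u)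
  rw [sub_self] at this
  rw [← this]
  apply intervalIntegral.integral_congr
  intro x _
  simp only
  rw [mul_comm, show u - s - (x - s) = u - x by ring]

lemma fs_beta_int (α β : ℝ) (hα : 0 < α) (hβ : 0 < β) (s u : ℝ) (hs : s < u) :
    IntervalIntegrable (fun w => (u - w) ^ (α - 1) * (w - s) ^ (β - 1)) volume s u := by
  by_contra h
  have h0 := intervalIntegral.integral_undef h
  rw [fs_beta' α β hα hβ s u hs] at h0
  have h1 := Real.rpow_pos_of_pos (sub_pos.2 hs) (α + β - 1)
  have h2 := Real.Gamma_pos_of_pos hα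
  have h3 := Real.Gamma_pos_of_pos hβ
  have h4 := Real.Gamma_pos_of_pos (add_pos hα hβ)
  have : 0 < (u - s) ^ (α + β - 1) * (Real.Gamma α * Real.Gamma β / Real.Gamma (α + β)) := by
    positivity
  linarith

lemma fs_ker_int (α : ℝ) (hα : 0 < α) (u : ℝ) :
    IntervalIntegrable (fun w => (u - w) ^ (α - 1)) volume 0 u := by
  have := (intervalIntegral.intervalIntegrable_rpow' (a := u) (b := 0)
    (show -1 < α - 1 by linarith)).comp_sub_left u
  simpa using this

lemma fs_ker_mul_int (α : ℝ) (hα : 0 < α) (u : ℝ) (hu : 0 ≤ u) (f : ℝ → ℝ)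
    (hf : ContinuousOn f (Icc 0 u)) :
    IntervalIntegrable (fun w => (u - w) ^ (α - 1) * f w) volume 0 u :=
  (fs_ker_int α hα u).mul_continuousOn (by rwa [uIcc_of_le hu])

lemma fs_left (u a : ℝ) (ha : a ≤ u) (ha0 : 0 ≤ a) (g : ℝ → ℝ) :
    ∫ x in Ioc 0 u, (Iio a).indicator g x = ∫ x in (0:ℝ)..a, g x := by
  rw [setIntegral_indicator measurableSet_Iio, intervalIntegral.integral_of_le ha0,
    integral_Ioc_eq_integral_Ioo]
  congr 2
  ext x
  simp only [mem_inter_iff, mem_Ioc, mem_Iio, mem_Ioo]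
  grind

lemma fs_right_set (u s : ℝ) (hs0 : 0 ≤ s) : Ioc 0 u ∩ Ioi s = Ioc s u := by
  ext x
  simp only [mem_inter_iff, mem_Ioc, mem_Ioi]
  grind

lemma fs_semi (α β : ℝ) (hα : 0 < α) (hβ : 0 < β) (f : ℝ → ℝ) (hf : Continuous f)
    (u : ℝ) (hu : 0 < u) :
    ∫ w in (0:ℝ)..u, (u - w) ^ (α - 1) * ∫ s in (0:ℝ)..w, (w - s) ^ (β - 1) * f s =
      (Real.Gamma α * Real.Gamma β / Real.Gamma (α + β)) *
        ∫ s in (0:ℝ)..u, (u - s) ^ (α + β - 1) * f s := by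
  set B := Real.Gamma α * Real.Gamma β / Real.Gamma (α + β) with hB
  let F : ℝ → ℝ → ℝ := fun w s =>
    if s < w then (u - w) ^ (α - 1) * (w - s) ^ (β - 1) * f s else 0
  have hF1 : ∀ w s, F w s = (Iio w).indicator
      (fun s => (u - w) ^ (α - 1) * ((w - s) ^ (β - 1) * f s)) s := by
    intro w s
    simp only [F, indicator, mem_Iio]
    split_ifs <;> ring
  have hF2 : ∀ s w, F w s = (Ioi s).indicator
      (fun w => ((u - w) ^ (α - 1) * (w - s) ^ (β - 1)) * f s) w := by
    intro s w
    simp only [F, indicator, mem_Ioi]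
  have hL : ∀ w ∈ Ioc 0 u, ∫ s in Ioc 0 u, F w s =
      (u - w) ^ (α - 1) * ∫ s in (0:ℝ)..w, (w - s) ^ (β - 1) * f s := by
    intro w hw
    simp_rw [hF1]
    rw [fs_left u w hw.2 hw.1.le, intervalIntegral.integral_const_mul]
  have hR : ∀ s ∈ Ioo 0 u, ∫ w in Ioc 0 u, F w s =
      (u - s) ^ (α + β - 1) * B * f s := by
    intro s hs
    simp_rw [hF2]
    rw [setIntegral_indicator measurableSet_Ioi, fs_right_set u s hs.1.le,
      ← intervalIntegral.integral_of_le hs.2.le, intervalIntegral.integral_mul_const,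
      fs_beta' α β hα hβ s u hs.2]
  have hRn : ∀ s ∈ Ioo 0 u, ∫ w in Ioc 0 u, ‖F w s‖ =
      (u - s) ^ (α + β - 1) * B * |f s| := by
    intro s hs
    have : ∀ w ∈ Ioc 0 u, ‖F w s‖ = (Ioi s).indicator
      (fun w => ((u - w) ^ (α - 1) * (w - s) ^ (β - 1)) * |f s|) w := by
      intro w hw
      rw [hF2]
      simp only [indicator, mem_Ioi]
      split_ifs with h
      · rw [Real.norm_eq_abs, abs_mul, abs_of_nonneg]
        exact mul_nonneg (Real.rpow_nonneg (by linarith [hw.2]) _)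
          (Real.rpow_nonneg (by linarith) _)
      · simp
    rw [setIntegral_congr_fun measurableSet_Ioc this]
    rw [setIntegral_indicator measurableSet_Ioi, fs_right_set u s hs.1.le,
      ← intervalIntegral.integral_of_le hs.2.le, intervalIntegral.integral_mul_const,
      fs_beta' α β hα hβ s u hs.2]
  have hmeas : Measurable (Function.uncurry F) := by
    have hfm := hf.measurable
    apply Measurable.ite (measurableSet_lt measurable_snd measurable_fst)
    · fun_prop
    · exact measurable_const
  have hint : Integrable (Function.uncurry F)
      ((volume.restrict (Ioc 0 u)).prod (volume.restrict (Ioc 0 u))) := by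
    rw [integrable_prod_iff' hmeas.aestronglyMeasurable]
    constructor
    · rw [← restrict_Ioo_eq_restrict_Ioc, ae_restrict_iff' measurableSet_Ioo]
      refine Eventually.of_forall fun s hs => ?_
      rw [restrict_Ioo_eq_restrict_Ioc]
      simp only [Function.uncurry]
      simp_rw [hF2]
      rw [integrable_indicator_iff measurableSet_Ioi, IntegrableOn,
        Measure.restrict_restrict measurableSet_Ioi, inter_comm, fs_right_set u s hs.1.le]
      exact (((fs_beta_int α β hα hβ s u hs.2).mul_const (f s)).1)
    · have hi : IntegrableOn (fun s => (u - s) ^ (α + β - 1) * B * |f s|) (Ioo 0 u) := by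
        have := (fs_ker_mul_int (α + β) (by linarith) u hu.le (fun s => B * |f s|)
          (by fun_prop)).1
        refine (this.mono_set Ioo_subset_Ioc_self).congr_fun ?_ measurableSet_Ioo
        intro s _
        simp only
        ring
      change IntegrableOn _ (Ioc 0 u)
      rw [integrableOn_Ioc_iff_integrableOn_Ioo]
      refine hi.congr_fun ?_ measurableSet_Ioo
      intro s hs
      exact (hRn s hs).symm
  have hsw := integral_integral_swap hint
  rw [setIntegral_congr_fun measurableSet_Ioc hL, ← intervalIntegral.integral_of_le hu.le] at hsw
  rw [hsw, integral_Ioc_eq_integral_Ioo, setIntegral_congr_fun measurableSet_Ioo hR,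
    intervalIntegral.integral_of_le hu.le, integral_Ioc_eq_integral_Ioo, ← integral_const_mul]
  congr 1
  ext s
  ring

lemma fs_RL_congr (α : ℝ) (f g : ℝ → ℝ) (u : ℝ) (hu : 0 ≤ u) (h : EqOn f g (Icc 0 u)) :
    RL α f u = RL α g u := by
  unfold RL
  split_ifs
  · exact h ⟨hu, le_rfl⟩
  · congr 1
    apply intervalIntegral.integral_congr
    intro x hx
    rw [uIcc_of_le hu] at hx
    simp only [h hx]

lemma fs_ext (T : ℝ) (hT : 0 ≤ T) (f : ℝ → ℝ) (hf : ContinuousOn f (Icc 0 T)) :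
    ∃ g : ℝ → ℝ, Continuous g ∧ EqOn f g (Icc 0 T) ∧ ∃ C, 0 ≤ C ∧ ∀ x, |g x| ≤ C := by
  refine ⟨fun x => f (projIcc 0 T hT x), ?_, ?_, ?_⟩
  · exact (continuousOn_iff_continuous_domRestrict.1 hf).comp continuous_projIcc
  · intro x hx
    simp only [projIcc_of_mem hT hx]
  · obtain ⟨C, hC⟩ := isCompact_Icc.exists_bound_of_continuousOn hf
    exact ⟨C, (norm_nonneg _).trans (hC 0 ⟨le_rfl, hT⟩), fun x => hC _ (projIcc 0 T hT x).2⟩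

lemma fs_RL_semi (α β : ℝ) (hα : 0 ≤ α) (hβ : 0 ≤ β) (T : ℝ) (f : ℝ → ℝ)
    (hf : ContinuousOn f (Icc 0 T)) (u : ℝ) (hu : u ∈ Icc 0 T) :
    RL α (RL β f) u = RL (α + β) f u := by
  rcases hα.eq_or_lt with rfl | hα
  · simp [RL]
  rcases hβ.eq_or_lt with rfl | hβ
  · have : RL 0 f = f := by ext; simp [RL]
    rw [this, add_zero]
  obtain ⟨g, hg, hfg, -⟩ := fs_ext T (hu.1.trans hu.2) f hf
  rw [fs_RL_congr (α + β) f g u hu.1 (hfg.mono (Icc_subset_Icc_right hu.2)),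
    fs_RL_congr α (RL β f) (RL β g) u hu.1 (fun x hx => fs_RL_congr β f g x hx.1
      (hfg.mono (Icc_subset_Icc_right (hx.2.trans hu.2))))]
  simp only [RL, hα.ne', hβ.ne', (add_pos hα hβ).ne', if_false]
  rcases hu.1.eq_or_lt with rfl | hu0
  · simp
  have := fs_semi α β hα hβ g hg u hu0
  have e : ∀ w : ℝ, (u - w) ^ (α - 1) * ((Real.Gamma β)⁻¹ *
      ∫ s in (0:ℝ)..w, (w - s) ^ (β - 1) * g s) =
      (Real.Gamma β)⁻¹ * ((u - w) ^ (α - 1) * ∫ s in (0:ℝ)..w, (w - s) ^ (β - 1) * g s) := by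
    intro w; ring
  simp_rw [e]
  rw [intervalIntegral.integral_const_mul, this]
  have h2 := (Real.Gamma_pos_of_pos hα).ne'
  have h3 := (Real.Gamma_pos_of_pos hβ).ne'
  have h4 := (Real.Gamma_pos_of_pos (add_pos hα hβ)).ne'
  field_simp

lemma fs_RL_scale (α : ℝ) (hα : 0 < α) (f : ℝ → ℝ) (u : ℝ) (hu : 0 ≤ u) :
    RL α f u = (Real.Gamma α)⁻¹ * (u ^ α * ∫ x in (0:ℝ)..1, (1 - x) ^ (α - 1) * f (u * x)) := by
  simp only [RL, hα.ne', if_false]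
  congr 1
  rcases hu.eq_or_lt with rfl | hu0
  · simp [Real.zero_rpow hα.ne']
  have := intervalIntegral.mul_integral_comp_mul_left
    (f := fun w => (u - w) ^ (α - 1) * f w) (a := 0) (b := 1) (c := u)
  rw [mul_zero, mul_one] at this
  rw [← this, ← intervalIntegral.integral_const_mul, ← intervalIntegral.integral_const_mul]
  apply intervalIntegral.integral_congr
  intro x hx
  rw [uIcc_of_le zero_le_one] at hx
  simp only
  rw [show u - u * x = u * (1 - x) by ring, Real.mul_rpow hu (by linarith [hx.2])]
  have : u ^ α = u * u ^ (α - 1) := by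
    rw [← Real.rpow_one_add' hu (by simpa using hα.ne')]; simp
  rw [this]; ring

lemma fs_RL_cont (α : ℝ) (hα : 0 ≤ α) (T : ℝ) (hT : 0 ≤ T) (f : ℝ → ℝ)
    (hf : ContinuousOn f (Icc 0 T)) :
    ContinuousOn (RL α f) (Icc 0 T) := by
  rcases hα.eq_or_lt with rfl | hα
  · have : RL 0 f = f := by ext; simp [RL]
    rwa [this]
  obtain ⟨g, hg, hfg, C, hC0, hC⟩ := fs_ext T hT f hf
  have hc : Continuous fun u : ℝ => (Real.Gamma α)⁻¹ *
      (u ^ α * ∫ x in (0:ℝ)..1, (1 - x) ^ (α - 1) * g (u * x)) := by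
    refine continuous_const.mul ((Real.continuous_rpow_const hα.le).mul ?_)
    refine intervalIntegral.continuous_of_dominated_interval
      (bound := fun x => |(1 - x) ^ (α - 1)| * C) ?_ ?_ ?_ ?_
    · intro u
      have := hg.measurable
      exact Measurable.aestronglyMeasurable (by fun_prop)
    · intro u
      refine Eventually.of_forall fun x _ => ?_
      rw [Real.norm_eq_abs, abs_mul]
      exact mul_le_mul_of_nonneg_left (hC _) (abs_nonneg _)
    · exact (fs_ker_int α hα 1).abs.mul_const C
    · exact Eventually.of_forall fun x _ => by fun_prop
  refine hc.continuousOn.congr fun u hu => ?_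
  refine Eq.trans ?_ (fs_RL_scale α hα g u hu.1)
  exact fs_RL_congr α f g u hu.1 (hfg.mono (Icc_subset_Icc_right hu.2))

lemma fs_RL_bound (α : ℝ) (hα : 0 < α) (T : ℝ) (hT : 0 ≤ T) (f : ℝ → ℝ)
    (hf : ContinuousOn f (Icc 0 T)) :
    ∃ C, ∀ u ∈ Icc 0 T, |RL α f u| ≤ C * u ^ α := by
  obtain ⟨g, hg, hfg, C, hC0, hC⟩ := fs_ext T hT f hf
  refine ⟨|(Real.Gamma α)⁻¹| * ∫ x in (0:ℝ)..1, |(1 - x) ^ (α - 1)| * C, fun u hu => ?_⟩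
  rw [fs_RL_congr α f g u hu.1 (hfg.mono (Icc_subset_Icc_right hu.2)),
    fs_RL_scale α hα g u hu.1, abs_mul, abs_mul, abs_of_nonneg (Real.rpow_nonneg hu.1 α)]
  have : |∫ x in (0:ℝ)..1, (1 - x) ^ (α - 1) * g (u * x)| ≤
      ∫ x in (0:ℝ)..1, |(1 - x) ^ (α - 1)| * C := by
    rw [← Real.norm_eq_abs]
    refine intervalIntegral.norm_integral_le_of_norm_le zero_le_one ?_
      ((fs_ker_int α hα 1).abs.mul_const C)
    refine Eventually.of_forall fun x _ => ?_
    rw [Real.norm_eq_abs, abs_mul]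
    exact mul_le_mul_of_nonneg_left (hC _) (abs_nonneg _)
  rw [mul_assoc, mul_comm (u ^ α)]
  have h1 := Real.rpow_nonneg hu.1 α
  gcongr

lemma fs_RL_add (α : ℝ) (hα : 0 ≤ α) (u : ℝ) (hu : 0 ≤ u) (f g : ℝ → ℝ)
    (hf : ContinuousOn f (Icc 0 u)) (hg : ContinuousOn g (Icc 0 u)) :
    RL α (fun x => f x + g x) u = RL α f u + RL α g u := by
  rcases hα.eq_or_lt with rfl | hα
  · simp [RL]
  simp only [RL, hα.ne', if_false, mul_add]
  rw [intervalIntegral.integral_add (fs_ker_mul_int α hα u hu f hf)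
    (fs_ker_mul_int α hα u hu g hg), mul_add]

lemma fs_RL_sub (α : ℝ) (hα : 0 ≤ α) (u : ℝ) (hu : 0 ≤ u) (f g : ℝ → ℝ)
    (hf : ContinuousOn f (Icc 0 u)) (hg : ContinuousOn g (Icc 0 u)) :
    RL α (fun x => f x - g x) u = RL α f u - RL α g u := by
  rcases hα.eq_or_lt with rfl | hα
  · simp [RL]
  simp only [RL, hα.ne', if_false, mul_sub]
  rw [intervalIntegral.integral_sub (fs_ker_mul_int α hα u hu f hf)
    (fs_ker_mul_int α hα u hu g hg), mul_sub]

lemma fs_RL_sum (α : ℝ) (hα : 0 ≤ α) (u : ℝ) (hu : 0 ≤ u) {ι : Type*} (s : Finset ι)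
    (f : ι → ℝ → ℝ) (hf : ∀ i, ContinuousOn (f i) (Icc 0 u)) :
    RL α (fun x => ∑ i ∈ s, f i x) u = ∑ i ∈ s, RL α (f i) u := by
  classical
  induction s using Finset.induction_on with
  | empty => simp [RL]
  | insert a s ha ih =>
    simp only [Finset.sum_insert ha]
    rw [fs_RL_add α hα u hu _ _ (hf a) (continuousOn_finsetSum _ fun i _ => hf i), ih]

lemma fs_RL_zero (α : ℝ) (u : ℝ) (hu : 0 ≤ u) (f : ℝ → ℝ) (hf : ∀ x ∈ Icc 0 u, f x = 0) :
    RL α f u = 0 := by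
  rw [fs_RL_congr α f (fun _ => 0) u hu hf]
  simp [RL]

lemma fs_taylor (T : ℝ) (m : ℕ) (hm : 1 ≤ m) (v : ℝ → ℝ)
    (hv : ContDiffOn ℝ m v (Icc 0 T)) (t : ℝ) (ht : t ∈ Icc 0 T) :
    v t = ∑ k ∈ Finset.range m,
        (iteratedDerivWithin k v (Icc 0 T) 0 / (k.factorial : ℝ)) * t ^ k +
      RL m (iteratedDerivWithin m v (Icc 0 T)) t := by
  obtain ⟨n, rfl⟩ : ∃ n, m = n + 1 := ⟨m - 1, by omega⟩
  rcases ht.1.eq_or_lt with rfl | ht0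
  · have h0 : RL ((n + 1 : ℕ) : ℝ) (iteratedDerivWithin (n + 1) v (Icc 0 T)) 0 = 0 := by
      have : ((n + 1 : ℕ) : ℝ) ≠ 0 := by positivity
      simp only [RL, this, if_false]
      simp
    rw [h0, Finset.sum_range_succ']
    simp
  have hs : ∀ k, ∀ x ∈ Ico 0 t, iteratedDerivWithin k v (Icc 0 t) x =
      iteratedDerivWithin k v (Icc 0 T) x := by
    intro k x hx
    unfold iteratedDerivWithin
    rw [iteratedFDerivWithin_congr_set]
    filter_upwards [Iio_mem_nhds hx.2] with y hy
    apply propext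
    change y ∈ Icc 0 t ↔ y ∈ Icc 0 T
    have := ht.2
    simp only [mem_Icc, mem_Iio] at *
    grind
  have h := taylor_integral_remainder (f := v) (x := t) (x₀ := 0) (n := n)
    (by rw [uIcc_of_le ht.1]; exact hv.mono (Icc_subset_Icc_right ht.2))
  rw [uIcc_of_le ht.1, taylor_within_apply] at h
  have e1 : ∑ k ∈ Finset.range (n + 1), (((k.factorial : ℝ))⁻¹ * (t - 0) ^ k) •
      iteratedDerivWithin k v (Icc 0 t) 0 = ∑ k ∈ Finset.range (n + 1),
        (iteratedDerivWithin k v (Icc 0 T) 0 / (k.factorial : ℝ)) * t ^ k := by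
    refine Finset.sum_congr rfl fun k _ => ?_
    rw [hs k 0 ⟨le_rfl, ht0⟩, smul_eq_mul, sub_zero]
    ring
  rw [e1] at h
  rw [← sub_eq_iff_eq_add', h]
  have : ((n + 1 : ℕ) : ℝ) ≠ 0 := by positivity
  simp only [RL, this, if_false]
  push_cast
  rw [Real.Gamma_nat_eq_factorial, ← intervalIntegral.integral_const_mul,
    intervalIntegral.integral_of_le ht.1, intervalIntegral.integral_of_le ht.1,
    integral_Ioc_eq_integral_Ioo, integral_Ioc_eq_integral_Ioo]
  refine setIntegral_congr_fun measurableSet_Ioo fun x hx => ?_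
  rw [hs (n + 1) x ⟨hx.1.le, hx.2⟩, smul_eq_mul, add_sub_cancel_right, Real.rpow_natCast]
  ring

lemma fs_inj_one (T : ℝ) (hT : 0 < T) (f : ℝ → ℝ) (hf : ContinuousOn f (Icc 0 T))
    (h : ∀ t ∈ Icc 0 T, RL 1 f t = 0) : ∀ t ∈ Icc 0 T, f t = 0 := by
  obtain ⟨g, hg, hfg, -⟩ := fs_ext T hT.le f hf
  have hg0 : ∀ t ∈ Icc 0 T, ∫ w in (0:ℝ)..t, g w = 0 := by
    intro t ht
    have := h t ht
    rw [fs_RL_congr 1 f g t ht.1 (hfg.mono (Icc_subset_Icc_right ht.2))] at this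
    simpa [RL] using this
  intro t ht
  rw [hfg ht]
  have h1 : HasDerivWithinAt (fun u => ∫ w in (0:ℝ)..u, g w) (g t) (Icc 0 T) t :=
    (hg.integral_hasStrictDerivAt 0 t).hasDerivAt.hasDerivWithinAt
  have h2 : HasDerivWithinAt (fun u => ∫ w in (0:ℝ)..u, g w) 0 (Icc 0 T) t :=
    (hasDerivWithinAt_const t (Icc 0 T) (0:ℝ)).congr hg0 (hg0 t ht)
  exact (uniqueDiffOn_Icc hT t ht).eq_deriv _ h1 h2

lemma fs_inj (T : ℝ) (hT : 0 < T) (m : ℕ) : ∀ (f : ℝ → ℝ), ContinuousOn f (Icc 0 T) →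
    (∀ t ∈ Icc 0 T, RL m f t = 0) → ∀ t ∈ Icc 0 T, f t = 0 := by
  induction m with
  | zero => intro f _ h; simpa [RL] using h
  | succ m ih =>
    intro f hf h
    refine ih f hf (fs_inj_one T hT _ (fs_RL_cont m (by positivity) T hT.le f hf) ?_)
    intro t ht
    rw [fs_RL_semi 1 m zero_le_one (by positivity) T f hf t ht, add_comm]
    simpa using h t ht

lemma fs_poly (T : ℝ) (hT : 0 < T) (m : ℕ) : ∀ (c : ℕ → ℝ) (θ C : ℝ), (m : ℝ) - 1 < θ →
    (∀ t ∈ Ioc 0 T, |∑ k ∈ Finset.range m, c k * t ^ k| ≤ C * t ^ θ) → ∀ k < m, c k = 0 := by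
  induction m with
  | zero => intro c θ C _ _ k hk; omega
  | succ m ih =>
    intro c θ C hθ h
    push_cast at hθ
    have hθ0 : 0 < θ := by
      have : (0:ℝ) ≤ m := by positivity
      linarith
    have hc0 : c 0 = 0 := by
      have l1 : Tendsto (fun t : ℝ => |∑ k ∈ Finset.range (m + 1), c k * t ^ k|) (𝓝[>] 0)
          (𝓝 |∑ k ∈ Finset.range (m + 1), c k * (0:ℝ) ^ k|) :=
        (Continuous.tendsto (by fun_prop) _).mono_left nhdsWithin_le_nhds
      have l2 : Tendsto (fun t : ℝ => C * t ^ θ) (𝓝[>] 0) (𝓝 (C * 0 ^ θ)) :=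
        ((continuous_const.mul (Real.continuous_rpow_const hθ0.le)).tendsto _).mono_left
          nhdsWithin_le_nhds
      have := le_of_tendsto_of_tendsto l1 l2 (by
        filter_upwards [Ioc_mem_nhdsGT hT] with t ht using h t ht)
      rw [Finset.sum_range_succ', Real.zero_rpow hθ0.ne'] at this
      simpa using this
    have := ih (fun k => c (k + 1)) (θ - 1) C (by linarith) (by
      intro t ht
      have h1 := h t ht
      rw [Finset.sum_range_succ', hc0, zero_mul, add_zero] at h1
      have e : ∑ k ∈ Finset.range m, c (k + 1) * t ^ (k + 1) =
          t * ∑ k ∈ Finset.range m, c (k + 1) * t ^ k := by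
        rw [Finset.mul_sum]
        exact Finset.sum_congr rfl fun k _ => by ring
      have e2 : t ^ θ = t * t ^ (θ - 1) := by
        rw [← Real.rpow_one_add' ht.1.le (by simpa using hθ0.ne')]; simp
      rw [e, e2, abs_mul, abs_of_pos ht.1, mul_left_comm] at h1
      exact le_of_mul_le_mul_left h1 ht.1)
    intro k hk
    rcases k with _ | k
    · exact hc0
    · exact this k (by omega)

lemma fs_single (T : ℝ) (hT : 0 < T) (θ : ℝ) (hθ : 0 < θ) (g v : ℝ → ℝ)
    (hg : ContinuousOn g (Icc 0 T)) (c : ℕ → ℝ)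
    (hv : ContDiffOn ℝ (⌈θ⌉₊ : ℕ) v (Icc 0 T)) :
    (∀ t ∈ Icc (0:ℝ) T, v t =
      (∑ k ∈ Finset.range ⌈θ⌉₊, (c k / (k.factorial : ℝ)) * t ^ k) + RL θ g t) ↔
    ((∀ k < ⌈θ⌉₊, iteratedDerivWithin k v (Icc 0 T) 0 = c k) ∧
      ∀ t ∈ Icc (0:ℝ) T, caputo θ T v t = g t) := by
  have hm1 : 1 ≤ ⌈θ⌉₊ := Nat.one_le_iff_ne_zero.2 (Nat.ceil_pos.2 hθ).ne'
  have hle : θ ≤ (⌈θ⌉₊ : ℝ) := Nat.le_ceil θ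
  have hlt : (⌈θ⌉₊ : ℝ) - 1 < θ := by linarith [Nat.ceil_lt_add_one hθ.le]
  have htay := fs_taylor T ⌈θ⌉₊ hm1 v hv
  have hw := hv.continuousOn_iteratedDerivWithin le_rfl (uniqueDiffOn_Icc hT)
  unfold caputo
  set m := ⌈θ⌉₊
  set w := iteratedDerivWithin m v (Icc 0 T)
  have hβ : 0 ≤ (m : ℝ) - θ := by linarith
  have hDc := fs_RL_cont ((m : ℝ) - θ) hβ T hT.le w hw
  have hID : ∀ t ∈ Icc 0 T, RL θ (RL ((m : ℝ) - θ) w) t = RL m w t := by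
    intro t ht
    rw [fs_RL_semi θ _ hθ.le hβ T w hw t ht, add_sub_cancel]
  constructor
  · intro h
    have hhc : ContinuousOn (fun x => g x - RL ((m : ℝ) - θ) w x) (Icc 0 T) := hg.sub hDc
    have hsub : ∀ t ∈ Icc 0 T, RL θ (fun x => g x - RL ((m : ℝ) - θ) w x) t =
        RL θ g t - RL m w t := by
      intro t ht
      have hss : Icc 0 t ⊆ Icc 0 T := Icc_subset_Icc_right ht.2
      rw [fs_RL_sub θ hθ.le t ht.1 _ _ (hg.mono hss) (hDc.mono hss), hID t ht]
    have hpoly : ∀ t ∈ Icc 0 T, ∑ k ∈ Finset.range m,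
        ((iteratedDerivWithin k v (Icc 0 T) 0 - c k) / (k.factorial : ℝ)) * t ^ k =
        RL θ (fun x => g x - RL ((m : ℝ) - θ) w x) t := by
      intro t ht
      rw [hsub t ht]
      simp only [sub_div, sub_mul, Finset.sum_sub_distrib]
      linarith [h t ht, htay t ht]
    obtain ⟨C, hC⟩ := fs_RL_bound θ hθ T hT.le _ hhc
    have hz := fs_poly T hT m _ θ C hlt (fun t ht => by
      rw [hpoly t ⟨ht.1.le, ht.2⟩]; exact hC t ⟨ht.1.le, ht.2⟩)
    have hz' : ∀ k < m, iteratedDerivWithin k v (Icc 0 T) 0 = c k := by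
      intro k hk
      have := hz k hk
      rw [div_eq_zero_iff] at this
      rcases this with h1 | h1
      · linarith
      · exact absurd h1 (by positivity)
    refine ⟨hz', ?_⟩
    have h0 : ∀ t ∈ Icc 0 T, RL θ (fun x => g x - RL ((m : ℝ) - θ) w x) t = 0 := by
      intro t ht
      rw [← hpoly t ht]
      refine Finset.sum_eq_zero fun k hk => ?_
      rw [hz k (Finset.mem_range.1 hk), zero_mul]
    have h1 := fs_inj T hT m _ hhc (fun t ht => by
      have := fs_RL_semi ((m : ℝ) - θ) θ hβ hθ.le T _ hhc t ht
      rw [sub_add_cancel] at this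
      rw [← this]
      exact fs_RL_zero _ t ht.1 _ fun x hx => h0 x ⟨hx.1, hx.2.trans ht.2⟩)
    intro t ht
    linarith [h1 t ht]
  · rintro ⟨h1, h2⟩ t ht
    rw [htay t ht, ← hID t ht]
    congr 1
    · refine Finset.sum_congr rfl fun k hk => ?_
      rw [h1 k (Finset.mem_range.1 hk)]
    · exact fs_RL_congr θ _ _ t ht.1 fun x hx => h2 x ⟨hx.1, hx.2.trans ht.2⟩

end FracSys

theorem integral_system_iff_fractional_system
    (n : ℕ) (hn : 1 ≤ n) (T : ℝ) (hT : 0 < T)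
    (θ : Fin n → ℝ) (hθpos : ∀ j, 0 < θ j) (hθrat : ∀ j, ∃ r : ℚ, θ j = (r : ℝ))
    (p : Fin n → Fin (n + 1) → ℝ → ℝ)
    (hp : ∀ j r, ContinuousOn (p j r) (Set.Icc 0 T))
    (v : Fin n → ℝ → ℝ) (hv : ∀ j, ContinuousOn (v j) (Set.Icc 0 T))
    (v0 : Fin n → ℕ → ℝ)
    (hsmooth : ∀ j, ContDiffOn ℝ (⌈θ j⌉₊ : ℕ) (v j) (Set.Icc 0 T)) :
    (∀ j, ∀ t ∈ Set.Icc (0:ℝ) T,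
        v j t =
          (∑ k ∈ Finset.range ⌈θ j⌉₊, (v0 j k / (k.factorial : ℝ)) * t ^ k) +
          (∑ r : Fin n, RL (θ j) (fun s => p j r.castSucc s * v r s) t) +
          RL (θ j) (p j (Fin.last n)) t) ↔
    (∀ j,
        (∀ k < ⌈θ j⌉₊, iteratedDerivWithin k (v j) (Set.Icc 0 T) 0 = v0 j k) ∧
        ∀ t ∈ Set.Icc (0:ℝ) T,
          caputo (θ j) T (v j) t =
            (∑ r : Fin n, p j r.castSucc t * v r t) + p j (Fin.last n) t) := by
  refine forall_congr' fun j => ?_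
  have hg : ContinuousOn (fun t => (∑ r : Fin n, p j r.castSucc t * v r t) + p j (Fin.last n) t)
      (Set.Icc 0 T) :=
    (continuousOn_finsetSum _ fun r _ => (hp j _).mul (hv r)).add (hp j _)
  rw [← fs_single T hT (θ j) (hθpos j) _ (v j) hg (v0 j) (hsmooth j)]
  refine forall_congr' fun t => forall_congr' fun ht => ?_
  have hss : Set.Icc 0 t ⊆ Set.Icc 0 T := Set.Icc_subset_Icc_right ht.2
  rw [fs_RL_add (θ j) (hθpos j).le t ht.1 (fun t => ∑ r : Fin n, p j r.castSucc t * v r t)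
    (p j (Fin.last n))
    (continuousOn_finsetSum _ fun r _ => ((hp j _).mul (hv r)).mono hss) ((hp j _).mono hss),
    fs_RL_sum (θ j) (hθpos j).le t ht.1 Finset.univ (fun r s => p j r.castSucc s * v r s)
      (fun r => ((hp j _).mul (hv r)).mono hss), add_assoc]
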